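/- With the coordinate setup below, the tensor of affine deformation T^k_{ij} = Γ̃^k_{ij} − Γ^k_{ij} between the Levi-Civita connections of g̃ and g satisfies, at every point of U: T^k_{ij} = −(1/6)·(2·g_{ij}·θ*^k + g̃_{ij}·(θ^k + θ*^k)), where θ^k = g^{ks}θ_s and θ*^k = g^{ks}θ*_s. -/

import Mathlib

open scoped BigOperators

/-- Points of ℝ³. -/
abbrev Pt := Fin 3 → ℝ

/-- Partial derivative `∂_i f` at `p`. -/
noncomputable def pd (i : Fin 3) (f : Pt → ℝ) (p : Pt) : ℝ :=
  fderiv ℝ f p (Pi.single i 1)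

/-- The circulant structure `Q` with `Q¹₂ = Q²₃ = Q³₁ = 1`. -/
def Qmat : Matrix (Fin 3) (Fin 3) ℝ := !![0,1,0; 0,0,1; 1,0,0]

/-- The metric `g_{ij}`: diagonal entries `A`, off-diagonal entries `B`. -/
def gm (A B : Pt → ℝ) (i j : Fin 3) (p : Pt) : ℝ :=
  if i = j then A p else B p

/-- The associated metric `g̃_{ij} = g_{is} Q^s_j + g_{sj} Q^s_i`. -/
def gt (A B : Pt → ℝ) (i j : Fin 3) (p : Pt) : ℝ :=
  ∑ s, (gm A B i s p * Qmat s j + gm A B s j p * Qmat s i)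

/-- Christoffel symbols `Γ^k_{ij}` of a metric `h` with (pointwise) inverse `hinv`. -/
noncomputable def Gamma (h hinv : Fin 3 → Fin 3 → Pt → ℝ) (k i j : Fin 3) (p : Pt) : ℝ :=
  (1/2) * ∑ s, hinv k s p * (pd i (h s j) p + pd j (h s i) p - pd s (h i j) p)

/-- Fundamental tensor `F_{kij} = ∂_k g̃_{ij} − Γ^s_{ki} g̃_{sj} − Γ^s_{kj} g̃_{si}`
of the metric `h` (with inverse `hinv`) acting on `ht` (= the associated metric). -/
noncomputable def Ften (h hinv ht : Fin 3 → Fin 3 → Pt → ℝ) (k i j : Fin 3) (p : Pt) : ℝ :=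
  pd k (ht i j) p - (∑ s, Gamma h hinv s k i p * ht s j p)
    - (∑ s, Gamma h hinv s k j p * ht s i p)

/-- Lee form `θ_k = g^{ij} F_{ijk}`. -/
noncomputable def theta (h hinv ht : Fin 3 → Fin 3 → Pt → ℝ) (k : Fin 3) (p : Pt) : ℝ :=
  ∑ i, ∑ j, hinv i j p * Ften h hinv ht i j k p

/-- Lee form `θ*_k = g^{ij} Q^s_j F_{isk}`. -/
noncomputable def thetaStar (h hinv ht : Fin 3 → Fin 3 → Pt → ℝ) (k : Fin 3) (p : Pt) : ℝ :=
  ∑ i, ∑ j, ∑ s, hinv i j p * Qmat s j * Ften h hinv ht i s k p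


theorem pd_gm (A B : Pt → ℝ) (k i j : Fin 3) (p : Pt) :
    pd k (gm A B i j) p = if i = j then pd k A p else pd k B p := by
  unfold pd
  have : gm A B i j = if i = j then A else B := by
    funext q; unfold gm; split_ifs <;> rfl
  rw [this]; split_ifs <;> rfl

theorem gt_eq (A B : Pt → ℝ) (i j : Fin 3) (p : Pt) :
    gt A B i j p = if i = j then 2 * B p else A p + B p := by
  fin_cases i <;> fin_cases j <;> simp [gt, gm, Qmat, Fin.sum_univ_three] <;> ring

theorem pd_gt (A B : Pt → ℝ) (p : Pt) (hA : DifferentiableAt ℝ A p)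
    (hB : DifferentiableAt ℝ B p) (k i j : Fin 3) :
    pd k (gt A B i j) p = if i = j then 2 * pd k B p else pd k A p + pd k B p := by
  unfold pd
  have : gt A B i j = if i = j then (fun q => 2 * B q) else (fun q => A q + B q) := by
    funext q; rw [gt_eq]; split_ifs <;> rfl
  rw [this]; split_ifs
  · rw [fderiv_const_mul hB]; simp
  · rw [fderiv_fun_add hA hB]; simp

/-- inverse of a matrix with constant diagonal and constant off-diagonal entries -/
theorem inv_circ (x y : ℝ) (h1 : x - y ≠ 0) (h2 : x + 2 * y ≠ 0) (m : Fin 3 → Fin 3 → ℝ)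
    (h : ∀ i j, (∑ s, (if i = s then x else y) * m s j) = if i = j then (1:ℝ) else 0)
    (i j : Fin 3) :
    m i j = (if i = j then x + y else -y) / ((x - y) * (x + 2 * y)) := by
  have e0 := h 0 j
  have e1 := h 1 j
  have e2 := h 2 j
  rw [eq_div_iff (mul_ne_zero h1 h2)]
  fin_cases i <;> fin_cases j <;> simp [Fin.sum_univ_three] at e0 e1 e2 ⊢
  · linear_combination (x + y) * e0 - y * e1 - y * e2
  · linear_combination (x + y) * e0 - y * e1 - y * e2
  · linear_combination (x + y) * e0 - y * e1 - y * e2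
  · linear_combination (x + y) * e1 - y * e0 - y * e2
  · linear_combination (x + y) * e1 - y * e0 - y * e2
  · linear_combination (x + y) * e1 - y * e0 - y * e2
  · linear_combination (x + y) * e2 - y * e1 - y * e0
  · linear_combination (x + y) * e2 - y * e1 - y * e0
  · linear_combination (x + y) * e2 - y * e1 - y * e0

set_option maxHeartbeats 4000000 in
/-- the affine deformation tensor `T^k_{ij} = Γ̃^k_{ij} − Γ^k_{ij}`
satisfies `T^k_{ij} = −(1/6)(2 g_{ij} θ*^k + g̃_{ij}(θ^k + θ*^k))`, where indices of
the Lee forms are raised by `g`: `θ^k = g^{ks}θ_s`, `θ*^k = g^{ks}θ*_s`. -/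
theorem affine_deformation_tensor
    (U : Set Pt) (hU : IsOpen U) (A B : Pt → ℝ)
    (hA : ContDiffOn ℝ (⊤ : ℕ∞) A U) (hB : ContDiffOn ℝ (⊤ : ℕ∞) B U)
    (hpos : ∀ p ∈ U, 0 < B p ∧ B p < A p)
    (ginv gtinv : Fin 3 → Fin 3 → Pt → ℝ)
    (hginv : ∀ p ∈ U, ∀ i j, (∑ s, gm A B i s p * ginv s j p) = if i = j then (1:ℝ) else 0)
    (hgtinv : ∀ p ∈ U, ∀ i j, (∑ s, gt A B i s p * gtinv s j p) = if i = j then (1:ℝ) else 0) :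
    ∀ p ∈ U, ∀ k i j,
      Gamma (gt A B) gtinv k i j p - Gamma (gm A B) ginv k i j p =
        -(1/6) * (2 * gm A B i j p *
            (∑ s, ginv k s p * thetaStar (gm A B) ginv (gt A B) s p)
          + gt A B i j p *
            (∑ s, ginv k s p * (theta (gm A B) ginv (gt A B) s p
              + thetaStar (gm A B) ginv (gt A B) s p))) := by
  intro p hp
  have dA : DifferentiableAt ℝ A p :=
    (hA.contDiffAt (hU.mem_nhds hp)).differentiableAt (by simp)
  have dB : DifferentiableAt ℝ B p :=
    (hB.contDiffAt (hU.mem_nhds hp)).differentiableAt (by simp)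
  obtain ⟨hy, hxy⟩ := hpos p hp
  have h1 : A p - B p ≠ 0 := by linarith
  have h2 : A p + 2 * B p ≠ 0 := by linarith
  have G := inv_circ (A p) (B p) h1 h2 (fun i j => ginv i j p) (hginv p hp)
  have T := inv_circ (2 * B p) (A p + B p) (by intro h; apply h1; linarith)
    (by intro h; apply h2; linarith) (fun i j => gtinv i j p)
    (by intro i j; rw [← hgtinv p hp i j]; simp only [gt_eq])
  have T' : ∀ i j, gtinv i j p = (if i = j then -(A p + 3 * B p) / 2 else (A p + B p) / 2)
      / ((A p - B p) * (A p + 2 * B p)) := by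
    intro i j
    rw [T, div_eq_div_iff]
    · split_ifs <;> ring
    · refine mul_ne_zero ?_ ?_
      · intro h; apply h1; linarith
      · intro h; apply h2; linarith
    · exact mul_ne_zero h1 h2
  clear T
  obtain ⟨d, hd⟩ : ∃ d, d = ((A p - B p) * (A p + 2 * B p))⁻¹ := ⟨_, rfl⟩
  have hd1 : d * ((A p - B p) * (A p + 2 * B p)) = 1 := by
    rw [hd]; exact inv_mul_cancel₀ (mul_ne_zero h1 h2)
  simp only [div_eq_mul_inv _ ((A p - B p) * (A p + 2 * B p)), ← hd] at G T'
  have E : ∀ m j, (∑ s, ginv s m p * gt A B s j p) = if m = j then 0 else 1 := by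
    intro m j
    simp only [G, gt_eq, Fin.sum_univ_three]
    fin_cases m <;> fin_cases j <;> simp <;> first | ring1 | linear_combination hd1
  have Gt : ∀ k i j, (∑ s, Gamma (gm A B) ginv s k i p * gt A B s j p) =
      (1/2) * ∑ m, (if m = j then 0 else 1) *
        (pd k (gm A B m i) p + pd i (gm A B m k) p - pd m (gm A B k i) p) := by
    intro k i j
    simp only [← E, Gamma, Fin.sum_univ_three]
    ring
  have hF : ∀ k i j, Ften (gm A B) ginv (gt A B) k i j p = pd k (gt A B i j) p
      - (1/2) * (∑ m, (if m = j then 0 else 1) *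
        (pd k (gm A B m i) p + pd i (gm A B m k) p - pd m (gm A B k i) p))
      - (1/2) * (∑ m, (if m = i then 0 else 1) *
        (pd k (gm A B m j) p + pd j (gm A B m k) p - pd m (gm A B k j) p)) := by
    intro k i j
    rw [Ften, Gt, Gt]
  simp only [pd_gm, pd_gt A B p dA dB] at hF
  have hth : ∀ k, theta (gm A B) ginv (gt A B) k p = d * ((A p + 2 * B p) *
      (3 / 2 * (pd 0 A p + pd 1 A p + pd 2 A p - pd k A p) - 3 * pd k B p)
      - B p * (3 / 2 * (pd 0 A p + pd 1 A p + pd 2 A p) - 9 / 2 * pd k A p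
        + 3 * (pd 0 B p + pd 1 B p + pd 2 B p) - 9 * pd k B p)) := by
    intro k
    simp only [theta, hF, G, Fin.sum_univ_three]
    clear hF Gt E T' G hd1 hd h2 h1 hxy hy dA dB hginv hgtinv hpos hA hB
    fin_cases k <;> simp <;> ring
  have hts : ∀ k, thetaStar (gm A B) ginv (gt A B) k p = d * ((A p + 2 * B p) *
      (-(3 / 2) * pd k A p + 3 / 2 * (pd 0 B p + pd 1 B p + pd 2 B p) - 3 * pd k B p)
      - B p * (3 / 2 * (pd 0 A p + pd 1 A p + pd 2 A p) - 9 / 2 * pd k A p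
        + 3 * (pd 0 B p + pd 1 B p + pd 2 B p) - 9 * pd k B p)) := by
    intro k
    simp only [thetaStar, hF, G, Fin.sum_univ_three]
    clear hF Gt E T' G hd1 hd h2 h1 hxy hy dA dB hginv hgtinv hpos hA hB
    fin_cases k <;> simp [Qmat] <;> ring
  have fin : ∀ l r : ℝ, l * (d * ((A p - B p) * (A p + 2 * B p))) = r → l = r := by
    intro l r h; rw [← h, hd1, mul_one]
  intro k i j
  apply fin
  simp only [hth, hts, Gamma, pd_gm, pd_gt A B p dA dB, gt_eq, gm, G, T',
    Fin.sum_univ_three]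
  clear fin hth hts hF Gt E T' G hd1 hd h2 h1 hxy hy dA dB hginv hgtinv hpos hA hB
  generalize A p = x
  generalize B p = y
  generalize pd 0 A p = a0
  generalize pd 1 A p = a1
  generalize pd 2 A p = a2
  generalize pd 0 B p = b0
  generalize pd 1 B p = b1
  generalize pd 2 B p = b2
  fin_cases k <;> fin_cases i <;> fin_cases j <;> simp <;> ring
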